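/- Let N ≥ 1 and let 𝓔 = (E_i, X_i, θ_i : 1 ≤ i ≤ N) be an N-player abstract economy such that: (1) each E_i is a nonempty convex compact subset of a Euclidean space ℝ^{n_i}; (2) each X_i : E → 2^{E_i} is strict, upper semicontinuous, lower semicontinuous, and closed-valued; (3) each θ_i : Graph(X_i) → ℝ is continuous; and (4) for every 1 ≤ i ≤ N and every x ∈ E the function y ↦ θ_i(x, y) restricted to X_i(x) is quasi-concave. Then 𝓔 has a Nash equilibrium. -/

import Mathlib

/-!
STATEMENT 9 (Ichiishi's existence theorem): An N-player abstract economy whose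
decision spaces are nonempty convex compact subsets of Euclidean spaces, whose
constraint maps are strict, upper and lower semicontinuous, and closed-valued,
and whose payoff functions are continuous on the graph and quasi-concave in
the player's own variable on `X i x`, has a Nash equilibrium.
-/

open Set

/-- A set-valued map `F` is upper semicontinuous at every point: for every
open `V ⊇ F x` there is a neighborhood `U` of `x` with `F u ⊆ V` for all
`u ∈ U`. -/
def SVUpperSemicontinuous {α β : Type*} [TopologicalSpace α] [TopologicalSpace β]
    (F : α → Set β) : Prop :=
  ∀ x, ∀ V : Set β, IsOpen V → F x ⊆ V → ∀ᶠ u in nhds x, F u ⊆ V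

/-- A set-valued map `F` is lower semicontinuous at every point: for every
open `V` meeting `F x` there is a neighborhood `U` of `x` with
`F u ∩ V ≠ ∅` for all `u ∈ U`. -/
def SVLowerSemicontinuous {α β : Type*} [TopologicalSpace α] [TopologicalSpace β]
    (F : α → Set β) : Prop :=
  ∀ x, ∀ V : Set β, IsOpen V → (F x ∩ V).Nonempty → ∀ᶠ u in nhds x, (F u ∩ V).Nonempty

/-- `x` is a Nash equilibrium of the abstract economy with constraint maps `X`
and payoff functions `θ`. -/
def IsNashEquilibrium {N : ℕ} {E : Fin N → Type*}
    (X : ∀ i, (∀ j, E j) → Set (E i)) (θ : ∀ i, (∀ j, E j) → E i → ℝ)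
    (x : ∀ j, E j) : Prop :=
  ∀ i, x i ∈ X i x ∧ ∀ xi' ∈ X i x, θ i x xi' ≤ θ i x (x i)

set_option linter.unusedSectionVars false

namespace Ich

def Dom {P I : Type*} (r : I → P → ℕ) (S : Finset P) : Prop :=
  ∀ y, ∃ i, ∀ x ∈ S, r i y ≤ r i x

section comb
variable {P I : Type*} [DecidableEq P] [Fintype I] [DecidableEq I]

def Q (r : I → P → ℕ) (m : I → P) (k : I) : Set P := {y | ∀ l, l ≠ k → r l (m l) < r l y}

def MQ (r : I → P → ℕ) (m : I → P) (k : I) (x : P) : Prop :=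
  x ∈ Q r m k ∧ ∀ y ∈ Q r m k, r k y ≤ r k x

theorem m_surj {r : I → P → ℕ} (hr : ∀ i, Function.Injective (r i)) {τ : Finset P}
    (hD : Dom r τ) {m : I → P} (hm : ∀ i, m i ∈ τ) (hmin : ∀ i, ∀ x ∈ τ, r i (m i) ≤ r i x)
    {z : P} (hz : z ∈ τ) : ∃ i, m i = z := by
  obtain ⟨i, hi⟩ := hD z
  exact ⟨i, hr i (le_antisymm (hmin i z hz) (hi _ (hm i)))⟩

theorem m_inj {r : I → P → ℕ} (hr : ∀ i, Function.Injective (r i)) {τ : Finset P}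
    (hD : Dom r τ) {m : I → P} (hm : ∀ i, m i ∈ τ) (hmin : ∀ i, ∀ x ∈ τ, r i (m i) ≤ r i x)
    (hc : τ.card + 1 = Fintype.card I) {a b : I} (hab : a ≠ b) (hmab : m a = m b)
    {l l' : I} (hl : l ≠ b) (hl' : l' ≠ b) (h : m l = m l') : l = l' := by
  have himg : (Finset.univ.erase b).image m = τ := by
    ext z
    simp only [Finset.mem_image, Finset.mem_erase, Finset.mem_univ, and_true]
    constructor
    · rintro ⟨i, _, rfl⟩; exact hm i
    · intro hz
      obtain ⟨i, hi⟩ := m_surj hr hD hm hmin hz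
      by_cases hib : i = b
      · exact ⟨a, hab, by rw [hmab, ← hib, hi]⟩
      · exact ⟨i, hib, hi⟩
  have hcard : ((Finset.univ.erase b).image m).card = (Finset.univ.erase b : Finset I).card := by
    rw [himg, Finset.card_erase_of_mem (Finset.mem_univ _), Finset.card_univ]; omega
  have := Finset.card_image_iff.1 hcard
  exact this (by simp [hl]) (by simp [hl']) h

theorem notMem_of_Q {r : I → P → ℕ} (hr : ∀ i, Function.Injective (r i)) {τ : Finset P}
    (hD : Dom r τ) {m : I → P} (hm : ∀ i, m i ∈ τ) (hmin : ∀ i, ∀ x ∈ τ, r i (m i) ≤ r i x)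
    {a b : I} (hab : a ≠ b) (hmab : m a = m b) {x : P} (hx : x ∈ Q r m b) : x ∉ τ := by
  intro hxt
  obtain ⟨i, hi⟩ := m_surj hr hD hm hmin hxt
  by_cases hib : i = b
  · have := hx a hab
    rw [hmab, ← hib, hi] at this
    exact lt_irrefl _ this
  · have := hx i hib
    rw [hi] at this
    exact lt_irrefl _ this

theorem dom_of_MQ {r : I → P → ℕ} {τ : Finset P}
    (hD : Dom r τ) {m : I → P} (hm : ∀ i, m i ∈ τ) (hmin : ∀ i, ∀ x ∈ τ, r i (m i) ≤ r i x)
    {k : I} {x : P} (hx : MQ r m k x) : Dom r (insert x τ) := by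
  intro y
  by_cases hy : y ∈ Q r m k
  · refine ⟨k, fun z hz => ?_⟩
    have h1 := hx.2 y hy
    rcases Finset.mem_insert.1 hz with rfl | hz
    · exact h1
    · obtain ⟨i, hi⟩ := hD x
      have : i = k := by
        by_contra hik
        exact absurd (hi _ (hm i)) (not_le.2 (hx.1 i hik))
      subst this
      exact h1.trans (hi z hz)
  · simp only [Q, Set.mem_setOf_eq, not_forall, not_lt] at hy
    obtain ⟨l, hl, hy⟩ := hy
    refine ⟨l, fun z hz => ?_⟩
    rcases Finset.mem_insert.1 hz with rfl | hz
    · exact hy.trans (hx.1 l hl).le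
    · exact hy.trans (hmin l z hz)

theorem MQ_of_dom {r : I → P → ℕ} (hr : ∀ i, Function.Injective (r i)) {τ : Finset P}
    (hD : Dom r τ) {m : I → P} (hm : ∀ i, m i ∈ τ) (hmin : ∀ i, ∀ x ∈ τ, r i (m i) ≤ r i x)
    (hc : τ.card + 1 = Fintype.card I) {a b : I} (hab : a ≠ b) (hmab : m a = m b)
    {x : P} (hxt : x ∉ τ) (hS : Dom r (insert x τ)) : MQ r m a x ∨ MQ r m b x := by
  obtain ⟨k, hk⟩ := hS x
  have key : ∀ z ∈ τ, ∃ l, l ≠ k ∧ m l = z ∧ r l z ≤ r l x := by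
    intro z hz
    obtain ⟨l, hl⟩ := hS z
    refine ⟨l, ?_, ?_, hl x (by simp)⟩
    · rintro rfl
      have h1 := hl x (by simp)
      have h2 := hk z (by simp [hz])
      exact hxt (hr l (le_antisymm h2 h1) ▸ hz)
    · exact hr l (le_antisymm (hmin l z hz) (hl _ (by simp [hm l])))
  have hkab : k = a ∨ k = b := by
    by_contra hcon
    push Not at hcon
    obtain ⟨l, hlk, hl, -⟩ := key (m k) (hm k)
    by_cases hlb : l = b
    · subst hlb
      exact hcon.1 (m_inj hr hD hm hmin hc hab hmab hcon.2 hab (by rw [← hl, hmab]))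
    · exact hlk (m_inj hr hD hm hmin hc hab hmab hlb hcon.2 hl)
  have hinj : ∀ l l', l ≠ k → l' ≠ k → m l = m l' → l = l' := by
    intro l l' h1 h2 h3
    rcases hkab with rfl | rfl
    · exact m_inj hr hD hm hmin hc hab.symm hmab.symm h1 h2 h3
    · exact m_inj hr hD hm hmin hc hab hmab h1 h2 h3
  have hM : MQ r m k x := by
    refine ⟨fun l hl => ?_, fun y hy => ?_⟩
    · obtain ⟨l', hl', he, hle⟩ := key (m l) (hm l)
      have := hinj _ _ hl' hl he
      subst this
      refine lt_of_le_of_ne hle fun h => hxt ?_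
      rw [← hr _ h]; exact hm _
    · obtain ⟨i, hi⟩ := hS y
      by_cases hik : i = k
      · subst hik; exact hi x (by simp)
      · exact absurd (hi (m i) (by simp [hm i])) (not_le.2 (hy i hik))
  rcases hkab with rfl | rfl
  · exact Or.inl hM
  · exact Or.inr hM

theorem exists_MQ [Fintype P] (r : I → P → ℕ) (m : I → P) (k : I) (h : (Q r m k).Nonempty) :
    ∃ x, MQ r m k x := by
  obtain ⟨x, hx, hmax⟩ := Set.exists_max_image (Q r m k) (r k) (Set.toFinite _) h
  exact ⟨x, hx, hmax⟩

open Classical in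
theorem rooms_eq [Fintype P] {r : I → P → ℕ} (hr : ∀ i, Function.Injective (r i)) {τ : Finset P}
    (hD : Dom r τ) {m : I → P} (hm : ∀ i, m i ∈ τ) (hmin : ∀ i, ∀ x ∈ τ, r i (m i) ≤ r i x)
    (hc : τ.card + 1 = Fintype.card I) {a b : I} (hab : a ≠ b) (hmab : m a = m b) (S : Finset P) :
    ((Dom r S ∧ S.card = Fintype.card I) ∧ τ ⊆ S) ↔
      ∃ x, (MQ r m a x ∨ MQ r m b x) ∧ S = insert x τ := by
  constructor
  · rintro ⟨⟨hS, hSc⟩, hsub⟩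
    have h1 : (S \ τ).card = 1 := by
      rw [Finset.card_sdiff_of_subset hsub]; omega
    obtain ⟨x, hx⟩ := Finset.card_eq_one.1 h1
    have hxS : x ∈ S \ τ := by simp [hx]
    rw [Finset.mem_sdiff] at hxS
    have hSe : S = insert x τ := by
      rw [← Finset.sdiff_union_of_subset hsub, hx]; rfl
    refine ⟨x, ?_, hSe⟩
    exact MQ_of_dom hr hD hm hmin hc hab hmab hxS.2 (hSe ▸ hS)
  · rintro ⟨x, hx, rfl⟩
    have hxt : x ∉ τ := by
      rcases hx with hx | hx
      · exact notMem_of_Q hr hD hm hmin hab.symm hmab.symm hx.1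
      · exact notMem_of_Q hr hD hm hmin hab hmab hx.1
    refine ⟨⟨?_, by rw [Finset.card_insert_of_notMem hxt, hc]⟩, Finset.subset_insert _ _⟩
    rcases hx with hx | hx
    · exact dom_of_MQ hD hm hmin hx
    · exact dom_of_MQ hD hm hmin hx

theorem MQ_unique {r : I → P → ℕ} (hr : ∀ i, Function.Injective (r i)) {m : I → P} {k : I}
    {x y : P} (hx : MQ r m k x) (hy : MQ r m k y) : x = y :=
  hr k (le_antisymm (hy.2 x hx.1) (hx.2 y hy.1))

open Classical in
theorem rooms_two [Fintype P] {r : I → P → ℕ} (hr : ∀ i, Function.Injective (r i)) {τ : Finset P}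
    (hD : Dom r τ) {m : I → P} (hm : ∀ i, m i ∈ τ) (hmin : ∀ i, ∀ x ∈ τ, r i (m i) ≤ r i x)
    (hc : τ.card + 1 = Fintype.card I) {a b : I} (hab : a ≠ b) (hmab : m a = m b)
    (ha : (Q r m a).Nonempty) (hb : (Q r m b).Nonempty) :
    (Finset.univ.filter fun S : Finset P =>
      (Dom r S ∧ S.card = Fintype.card I) ∧ τ ⊆ S).card = 2 := by
  obtain ⟨x, hx⟩ := exists_MQ r m a ha
  obtain ⟨y, hy⟩ := exists_MQ r m b hb
  have hxy : x ≠ y := by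
    rintro rfl
    obtain ⟨i, hi⟩ := hD x
    have h1 := hi (m i) (hm i)
    by_cases hia : i = a
    · exact absurd h1 (not_le.2 (hy.1 i (hia ▸ hab)))
    · exact absurd h1 (not_le.2 (hx.1 i hia))
  have hxt := notMem_of_Q hr hD hm hmin hab.symm hmab.symm hx.1
  have hyt := notMem_of_Q hr hD hm hmin hab hmab hy.1
  rw [Finset.card_eq_two]
  refine ⟨insert x τ, insert y τ, ?_, ?_⟩
  · intro h
    have : x ∈ insert y τ := h ▸ Finset.mem_insert_self x τ
    rcases Finset.mem_insert.1 this with h | h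
    · exact hxy h
    · exact hxt h
  · ext S
    simp only [Finset.mem_filter, Finset.mem_univ, true_and, Finset.mem_insert,
      Finset.mem_singleton]
    rw [rooms_eq hr hD hm hmin hc hab hmab]
    constructor
    · rintro ⟨z, hz | hz, rfl⟩
      · left; rw [MQ_unique hr hz hx]
      · right; rw [MQ_unique hr hz hy]
    · rintro (rfl | rfl)
      · exact ⟨x, Or.inl hx, rfl⟩
      · exact ⟨y, Or.inr hy, rfl⟩

open Classical in
theorem rooms_one [Fintype P] {r : I → P → ℕ} (hr : ∀ i, Function.Injective (r i)) {τ : Finset P}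
    (hD : Dom r τ) {m : I → P} (hm : ∀ i, m i ∈ τ) (hmin : ∀ i, ∀ x ∈ τ, r i (m i) ≤ r i x)
    (hc : τ.card + 1 = Fintype.card I) {a b : I} (hab : a ≠ b) (hmab : m a = m b)
    (ha : (Q r m a).Nonempty) (hb : ¬ (Q r m b).Nonempty) :
    (Finset.univ.filter fun S : Finset P =>
      (Dom r S ∧ S.card = Fintype.card I) ∧ τ ⊆ S).card = 1 := by
  obtain ⟨x, hx⟩ := exists_MQ r m a ha
  rw [Finset.card_eq_one]
  refine ⟨insert x τ, ?_⟩
  ext S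
  simp only [Finset.mem_filter, Finset.mem_univ, true_and, Finset.mem_singleton]
  rw [rooms_eq hr hD hm hmin hc hab hmab]
  constructor
  · rintro ⟨z, hz | hz, rfl⟩
    · rw [MQ_unique hr hz hx]
    · exact absurd ⟨z, hz.1⟩ hb
  · rintro rfl
    exact ⟨x, Or.inl hx, rfl⟩

/-- a room which is not fully coloured has an even number of doors -/
theorem doors_even [Fintype P] (c : P → I) (i0 : I) (S : Finset P)
    (hS : S.card = Fintype.card I) (hcS : S.image c ≠ Finset.univ) :
    Even (Finset.univ.filter fun τ : Finset P =>
      (τ.card + 1 = Fintype.card I ∧ τ.image c = Finset.univ.erase i0) ∧ τ ⊆ S).card := by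
  set F := Finset.univ.filter fun τ : Finset P =>
      (τ.card + 1 = Fintype.card I ∧ τ.image c = Finset.univ.erase i0) ∧ τ ⊆ S with hF
  by_cases hne : F.Nonempty
  swap
  · rw [Finset.not_nonempty_iff_eq_empty.1 hne]; simp
  obtain ⟨τ, hτ⟩ := hne
  simp only [hF, Finset.mem_filter, Finset.mem_univ, true_and] at hτ
  obtain ⟨⟨hτc, hτi⟩, hτS⟩ := hτ
  have himg : S.image c = Finset.univ.erase i0 := by
    have h1 : Finset.univ.erase i0 ⊆ S.image c := hτi ▸ Finset.image_subset_image hτS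
    refine (Finset.Subset.antisymm h1 ?_).symm
    intro z hz
    rw [Finset.mem_erase]
    refine ⟨?_, Finset.mem_univ _⟩
    rintro rfl
    apply hcS
    ext w
    simp only [Finset.mem_univ, iff_true]
    by_cases hw : w = z
    · rw [hw]; exact hz
    · exact h1 (by simp [hw])
  have hcard : (Finset.univ.erase i0 : Finset I).card + 1 = Fintype.card I := by
    rw [Finset.card_erase_of_mem (Finset.mem_univ _), Finset.card_univ]
    have : 0 < Fintype.card I := Fintype.card_pos_iff.2 ⟨i0⟩
    omega
  obtain ⟨x, hx, x', hx', hxx, hcx⟩ : ∃ x ∈ S, ∃ x' ∈ S, x ≠ x' ∧ c x = c x' := by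
    apply Finset.exists_ne_map_eq_of_card_lt_of_maps_to (t := Finset.univ.erase i0)
    · omega
    · intro z hz; rw [← himg]; exact Finset.mem_coe.2 (Finset.mem_image_of_mem c hz)
  have herase : ∀ x ∈ S, ∀ x' ∈ S, x ≠ x' → c x = c x' → S.erase x ∈ F := by
    intro x hx x' hx' hxx hcx
    simp only [hF, Finset.mem_filter, Finset.mem_univ, true_and]
    refine ⟨⟨?_, ?_⟩, Finset.erase_subset _ _⟩
    · rw [Finset.card_erase_add_one hx, hS]
    · rw [← himg]
      apply Finset.Subset.antisymm (Finset.image_subset_image (Finset.erase_subset _ _))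
      intro z hz
      obtain ⟨w, hw, rfl⟩ := Finset.mem_image.1 hz
      by_cases hwx : w = x
      · exact Finset.mem_image.2 ⟨x', by simp [hx', hxx.symm], by rw [hwx, hcx]⟩
      · exact Finset.mem_image.2 ⟨w, by simp [hw, hwx], rfl⟩
  have : F = {S.erase x, S.erase x'} := by
    ext ρ
    rw [Finset.mem_insert, Finset.mem_singleton]
    constructor
    · intro hρ
      simp only [hF, Finset.mem_filter, Finset.mem_univ, true_and] at hρ
      obtain ⟨⟨hρc, hρi⟩, hρS⟩ := hρ
      have hinj : Set.InjOn c ρ := by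
        apply Finset.card_image_iff.1
        rw [hρi]; omega
      have hor : x ∉ ρ ∨ x' ∉ ρ := by
        by_contra hcon
        push Not at hcon
        exact hxx (hinj hcon.1 hcon.2 hcx)
      rcases hor with h | h
      · left
        apply Finset.eq_of_subset_of_card_le
        · exact Finset.subset_erase.2 ⟨hρS, h⟩
        · rw [Finset.card_erase_of_mem hx]; omega
      · right
        apply Finset.eq_of_subset_of_card_le
        · exact Finset.subset_erase.2 ⟨hρS, h⟩
        · rw [Finset.card_erase_of_mem hx']; omega
    · rintro (rfl | rfl)
      · exact herase x hx x' hx' hxx hcx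
      · exact herase x' hx' x hx hxx.symm hcx.symm
  rw [this, Finset.card_pair]
  · exact even_two
  · intro h
    have : x' ∈ S.erase x := by simp [hx', hxx.symm]
    rw [h] at this
    simp at this

end comb

end Ich

namespace Ich

open Classical in
theorem scarf_aux {T I : Type*} [Fintype T] [Fintype I] [Nontrivial I]
    (r : I → T ⊕ I → ℕ) (hr : ∀ i, Function.Injective (r i))
    (e1 : ∀ i y, y ≠ Sum.inr i → r i (Sum.inr i) < r i y)
    (e2 : ∀ i j t, j ≠ i → r i (Sum.inl t) < r i (Sum.inr j))
    (c : T ⊕ I → I) (hcI : ∀ i, c (Sum.inr i) = i) :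
    ∃ S : Finset (T ⊕ I), Dom r S ∧ S.image c = Finset.univ := by
  by_contra hcon
  push Not at hcon
  obtain ⟨i0⟩ : Nonempty I := inferInstance
  have e1' : ∀ i y, r i (Sum.inr i) ≤ r i y := by
    intro i y
    by_cases h : y = Sum.inr i
    · rw [h]
    · exact (e1 i y h).le
  set R : Finset (Finset (T ⊕ I)) :=
    Finset.univ.filter fun S => Dom r S ∧ S.card = Fintype.card I with hR
  set D : Finset (Finset (T ⊕ I)) :=
    Finset.univ.filter fun τ => Dom r τ ∧
      (τ.card + 1 = Fintype.card I ∧ τ.image c = Finset.univ.erase i0) with hDdef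
  set τ0 : Finset (T ⊕ I) := (Finset.univ.erase i0).image Sum.inr with hτ0
  have hsum := Finset.sum_card_bipartiteAbove_eq_sum_card_bipartiteBelow
    (s := D) (t := R) (fun τ S : Finset (T ⊕ I) => τ ⊆ S)
  -- rooms
  have hRe : Even (∑ S ∈ R, (Finset.bipartiteBelow (fun τ S : Finset (T ⊕ I) => τ ⊆ S) D S).card) := by
    apply Finset.even_sum
    intro S hS
    simp only [hR, Finset.mem_filter, Finset.mem_univ, true_and] at hS
    have := doors_even c i0 S hS.2 (hcon S hS.1)
    suffices heq : Finset.bipartiteBelow (fun τ S : Finset (T ⊕ I) => τ ⊆ S) D S =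
        Finset.univ.filter fun τ : Finset (T ⊕ I) =>
          (τ.card + 1 = Fintype.card I ∧ τ.image c = Finset.univ.erase i0) ∧ τ ⊆ S by
      rw [heq]; convert this
    ext τ
    simp only [Finset.bipartiteBelow, hDdef, Finset.mem_filter, Finset.mem_univ, true_and]
    constructor
    · rintro ⟨⟨-, h⟩, h'⟩; exact ⟨h, h'⟩
    · rintro ⟨h, h'⟩
      refine ⟨⟨?_, h⟩, h'⟩
      intro y
      obtain ⟨i, hi⟩ := hS.1 y
      exact ⟨i, fun x hx => hi x (h' hx)⟩
  have hcardI : (Finset.univ.erase i0 : Finset I).card + 1 = Fintype.card I := by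
    rw [Finset.card_erase_of_mem (Finset.mem_univ _), Finset.card_univ]
    have : 0 < Fintype.card I := Fintype.card_pos_iff.2 ⟨i0⟩
    omega
  have hτ0D : τ0 ∈ D := by
    simp only [hDdef, Finset.mem_filter, Finset.mem_univ, true_and]
    refine ⟨?_, ?_, ?_⟩
    · intro y
      rcases y with t | p
      · refine ⟨i0, fun x hx => ?_⟩
        obtain ⟨j, hj, rfl⟩ := Finset.mem_image.1 hx
        exact (e2 i0 j t (Finset.ne_of_mem_erase hj)).le
      · exact ⟨p, fun x _ => e1' p x⟩
    · rw [hτ0, Finset.card_image_of_injective _ Sum.inr_injective, hcardI]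
    · rw [hτ0, Finset.image_image]
      have : c ∘ Sum.inr = id := funext hcI
      rw [this, Finset.image_id]
  have hfilt : ∀ τ, Finset.bipartiteAbove (fun τ S : Finset (T ⊕ I) => τ ⊆ S) R τ =
      Finset.univ.filter fun S : Finset (T ⊕ I) =>
        (Dom r S ∧ S.card = Fintype.card I) ∧ τ ⊆ S := by
    intro τ
    ext S
    simp only [Finset.bipartiteAbove, hR, Finset.mem_filter, Finset.mem_univ, true_and]
  have hmin : ∀ τ ∈ D, ∃ m : I → T ⊕ I, (∀ i, m i ∈ τ) ∧ ∀ i, ∀ x ∈ τ, r i (m i) ≤ r i x := by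
    intro τ hτ
    simp only [hDdef, Finset.mem_filter, Finset.mem_univ, true_and] at hτ
    have hne : τ.Nonempty := by
      rw [← Finset.card_pos]
      have := Fintype.one_lt_card (α := I)
      omega
    have : ∀ i, ∃ z ∈ τ, ∀ x ∈ τ, r i z ≤ r i x := fun i => Finset.exists_min_image τ (r i) hne
    choose m h1 h2 using this
    exact ⟨m, h1, h2⟩
  have htwo : ∀ τ ∈ D.erase τ0,
      (Finset.bipartiteAbove (fun τ S : Finset (T ⊕ I) => τ ⊆ S) R τ).card = 2 := by
    intro τ hτ
    obtain ⟨hne, hτ⟩ := Finset.mem_erase.1 hτ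
    obtain ⟨m, hm, hmm⟩ := hmin τ hτ
    simp only [hDdef, Finset.mem_filter, Finset.mem_univ, true_and] at hτ
    obtain ⟨hDom, hc1, hc2⟩ := hτ
    obtain ⟨t, ht⟩ : ∃ t, Sum.inl t ∈ τ := by
      by_contra hno
      push Not at hno
      apply hne
      apply Finset.eq_of_subset_of_card_le
      · intro z hz
        rcases z with t | p
        · exact absurd hz (hno t)
        · have : c (Sum.inr p) ∈ τ.image c := Finset.mem_image_of_mem c hz
          rw [hc2, hcI] at this
          exact Finset.mem_image_of_mem _ this
      · rw [hτ0, Finset.card_image_of_injective _ Sum.inr_injective]; omega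
    obtain ⟨a, -, b, -, hab, hmab⟩ : ∃ a ∈ (Finset.univ : Finset I), ∃ b ∈ (Finset.univ : Finset I),
        a ≠ b ∧ m a = m b := by
      apply Finset.exists_ne_map_eq_of_card_lt_of_maps_to (t := τ)
      · rw [Finset.card_univ]; omega
      · intro i _; exact hm i
    have hQ : ∀ k, (Q r m k).Nonempty := by
      intro k
      refine ⟨Sum.inr k, fun l hl => ?_⟩
      exact (hmm l _ ht).trans_lt (e2 l k t hl.symm)
    rw [hfilt]
    exact rooms_two hr hDom hm hmm hc1 hab hmab (hQ a) (hQ b)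
  have hone : (Finset.bipartiteAbove (fun τ S : Finset (T ⊕ I) => τ ⊆ S) R τ0).card = 1 := by
    obtain ⟨m, hm, hmm⟩ := hmin τ0 hτ0D
    have hτ0D' := hτ0D
    simp only [hDdef, Finset.mem_filter, Finset.mem_univ, true_and] at hτ0D'
    obtain ⟨hDom, hc1, hc2⟩ := hτ0D'
    have hml : ∀ l, l ≠ i0 → m l = Sum.inr l := by
      intro l hl
      apply hr l
      apply le_antisymm _ (e1' l _)
      exact hmm l _ (Finset.mem_image_of_mem _ (by simp [hl]))
    obtain ⟨j, hj, hmj⟩ := Finset.mem_image.1 (hm i0)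
    have hj0 : j ≠ i0 := Finset.ne_of_mem_erase hj
    rw [hfilt]
    refine rooms_one hr hDom hm hmm hc1 hj0.symm (by rw [hml j hj0, hmj]) ?_ ?_
    · refine ⟨Sum.inr i0, fun l hl => ?_⟩
      rw [hml l hl]
      exact e1 l _ (by simp [hl.symm])
    · rintro ⟨y, hy⟩
      have h0 := hy i0 hj0.symm
      rw [← hmj] at h0
      rcases y with t | p
      · exact absurd h0 (not_lt.2 (e2 i0 j t hj0).le)
      · by_cases hp0 : p = i0
        · subst hp0
          exact absurd h0 (not_lt.2 (e1' _ _))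
        by_cases hpj : p = j
        · subst hpj; exact lt_irrefl _ h0
        have := hy p hpj
        rw [hml p hp0] at this
        exact lt_irrefl _ this
  rw [← hsum, ← Finset.add_sum_erase D _ hτ0D, hone, Finset.sum_congr rfl htwo,
    Finset.sum_const, smul_eq_mul] at hRe
  rw [Nat.even_iff] at hRe
  omega

open Classical in
theorem scarf {T I : Type*} [Fintype T] [Fintype I] [Nontrivial I]
    (g : I → T → ℕ) (c : T → I) :
    ∃ σ : Finset T, ∀ y, ∃ i, (∃ x ∈ σ, c x = i) ∧ ∀ x ∈ σ, g i y ≤ g i x := by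
  let M := Fintype.card T
  let code : T → Fin M := Fintype.equivFin T
  have hcode : Function.Injective code := (Fintype.equivFin T).injective
  let idx : I → Fin (Fintype.card I) := Fintype.equivFin I
  have hidx : Function.Injective idx := (Fintype.equivFin I).injective
  let g' : I → T → ℕ := fun i t => M * g i t + code t
  have hle : ∀ i y x, g' i y ≤ g' i x → g i y ≤ g i x := by
    intro i y x h
    by_contra hlt
    push Not at hlt
    have h1 : M * (g i x + 1) ≤ M * g i y := Nat.mul_le_mul_left _ hlt
    have h2 := (code x).2
    simp only [g'] at h
    rw [mul_add] at h1
    omega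
  have hinj : ∀ i, Function.Injective (g' i) := by
    intro i x y h
    have h1 := le_antisymm (hle i x y h.le) (hle i y x h.ge)
    simp only [g', h1] at h
    exact hcode (Fin.ext (by omega))
  let B : ℕ := ∑ i, ∑ t, g' i t
  have hB : ∀ i t, g' i t ≤ B := by
    intro i t
    calc g' i t ≤ ∑ t, g' i t := Finset.single_le_sum (f := g' i) (fun _ _ => Nat.zero_le _) (Finset.mem_univ t)
      _ ≤ B := Finset.single_le_sum (f := fun i => ∑ t, g' i t) (fun _ _ => Nat.zero_le _) (Finset.mem_univ i)
  let r : I → T ⊕ I → ℕ := fun i => Sum.elim (fun t => g' i t + 1)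
    (fun j => if j = i then 0 else B + 2 + idx j)
  obtain ⟨S, hS, hSc⟩ := scarf_aux r (by
      intro i x y h
      rcases x with x | x <;> rcases y with y | y <;> simp only [r, Sum.elim_inl, Sum.elim_inr] at h
      · rw [hinj i (by omega : g' i x = g' i y)]
      · have := hB i x
        split_ifs at h <;> omega
      · have := hB i y
        split_ifs at h <;> omega
      · split_ifs at h with h1 h2 h2
        · rw [h1, h2]
        · omega
        · omega
        · rw [hidx (Fin.ext (by omega) : idx x = idx y)])
    (by
      intro i y hy
      rcases y with y | y
      · simp [r]
      · have : y ≠ i := fun h => hy (by rw [h])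
        simp [r, this])
    (by
      intro i j t hj
      have := hB i t
      simp only [r, Sum.elim_inl, Sum.elim_inr, if_neg hj]
      omega)
    (Sum.elim c id) (fun i => rfl)
  refine ⟨Finset.univ.filter fun t => Sum.inl t ∈ S, fun y => ?_⟩
  obtain ⟨i, hi⟩ := hS (Sum.inl y)
  refine ⟨i, ?_, ?_⟩
  · have : i ∈ S.image (Sum.elim c id) := by rw [hSc]; exact Finset.mem_univ _
    obtain ⟨z, hz, hzi⟩ := Finset.mem_image.1 this
    rcases z with t | j
    · exact ⟨t, by simpa using hz, hzi⟩
    · simp only [Sum.elim_inr, id] at hzi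
      subst hzi
      have := hi _ hz
      simp [r] at this
  · intro x hx
    have := hi (Sum.inl x) (by simpa using hx)
    simp only [r, Sum.elim_inl] at this
    exact hle i y x (by omega)

end Ich

namespace Ich

open Classical in
theorem brouwer_approx {I : Type*} [Fintype I] [Nontrivial I] (f : (I → ℝ) → (I → ℝ))
    (hf : ∀ p ∈ stdSimplex ℝ I, f p ∈ stdSimplex ℝ I) (m : ℕ) (hm : 0 < m) :
    ∃ p ∈ stdSimplex ℝ I, ∀ i, p i ≤ (Fintype.card I : ℝ) / m ∨
      ∃ q ∈ stdSimplex ℝ I, (∀ j, |p j - q j| ≤ (Fintype.card I : ℝ) / m) ∧ q i ≤ f q i := by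
  have hm' : (0 : ℝ) < m := by exact_mod_cast hm
  obtain ⟨i0⟩ : Nonempty I := inferInstance
  let T := {x : I → ℕ // x ∈ Finset.piAntidiag (Finset.univ : Finset I) m}
  have hT : ∀ x : T, ∑ i, x.1 i = m := fun x => (Finset.mem_piAntidiag.1 x.2).1
  let pt : T → I → ℝ := fun x i => (x.1 i : ℝ) / m
  have hpt : ∀ x, pt x ∈ stdSimplex ℝ I := by
    intro x
    refine ⟨fun i => by simp only [pt]; positivity, ?_⟩
    simp only [pt]
    rw [← Finset.sum_div, div_eq_one_iff_eq hm'.ne']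
    exact_mod_cast hT x
  have hcol : ∀ x : T, ∃ i, pt x i ≤ f (pt x) i := by
    intro x
    obtain ⟨i, -, hi⟩ := Finset.exists_le_of_sum_le (s := (Finset.univ : Finset I)) ⟨i0, Finset.mem_univ _⟩
      (f := pt x) (g := f (pt x)) (by rw [(hpt x).2, (hf _ (hpt x)).2])
    exact ⟨i, hi⟩
  choose c hc using hcol
  obtain ⟨σ, hσ⟩ := scarf (fun i (x : T) => x.1 i) c
  have mkT : ∀ y : I → ℕ, ∑ i, y i = m → ∃ t : T, t.1 = y := fun y hy =>
    ⟨⟨y, Finset.mem_piAntidiag.2 ⟨hy, fun _ _ => Finset.mem_univ _⟩⟩, rfl⟩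
  obtain ⟨t0, -⟩ := mkT (Pi.single i0 m) (by simp)
  obtain ⟨x0, hx0⟩ : σ.Nonempty := by
    obtain ⟨i, ⟨x, hx, -⟩, -⟩ := hσ t0
    exact ⟨x, hx⟩
  have hμ : ∀ i, ∃ z ∈ σ, ∀ x ∈ σ, z.1 i ≤ x.1 i := fun i =>
    Finset.exists_min_image σ (fun x : T => x.1 i) ⟨x0, hx0⟩
  choose z hz hzmin using hμ
  let ν : I → ℕ := fun i => if i ∈ σ.image c then (z i).1 i else 0
  have hνle : ∀ x ∈ σ, ∀ i, ν i ≤ x.1 i := by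
    intro x hx i
    simp only [ν]
    split_ifs
    · exact hzmin i x hx
    · exact Nat.zero_le _
  have hlt : m < ∑ i, ν i + Fintype.card I := by
    by_contra hcon
    push Not at hcon
    obtain ⟨y, hy⟩ := mkT (fun i => (ν i + 1) +
      (if i = i0 then m - (∑ i, ν i + Fintype.card I) else 0)) (by
        rw [Finset.sum_add_distrib, Finset.sum_add_distrib]
        simp
        omega)
    obtain ⟨i, ⟨x, hx, hxi⟩, hi⟩ := hσ y
    have h1 := hi (z i) (hz i)
    simp only [hy] at h1
    have h2 : ν i = (z i).1 i := by
      simp only [ν]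
      rw [if_pos (Finset.mem_image.2 ⟨x, hx, hxi⟩)]
    omega
  have hub : ∀ x ∈ σ, ∀ i, x.1 i ≤ ν i + Fintype.card I := by
    intro x hx i
    have h1 := Finset.add_sum_erase Finset.univ (fun i => x.1 i) (Finset.mem_univ i)
    have h2 := Finset.add_sum_erase Finset.univ (fun i => ν i) (Finset.mem_univ i)
    have h3 : ∑ j ∈ Finset.univ.erase i, ν j ≤ ∑ j ∈ Finset.univ.erase i, x.1 j :=
      Finset.sum_le_sum fun j _ => hνle x hx j
    have h4 := hT x
    omega
  refine ⟨pt x0, hpt x0, fun i => ?_⟩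
  by_cases hi : i ∈ σ.image c
  · right
    obtain ⟨x, hx, hxi⟩ := Finset.mem_image.1 hi
    refine ⟨pt x, hpt x, fun j => ?_, hxi ▸ hc x⟩
    simp only [pt]
    rw [← sub_div, abs_div, abs_of_pos hm']
    gcongr
    have a1 : (x.1 j : ℝ) ≤ ν j + Fintype.card I := by exact_mod_cast hub x hx j
    have a2 : (x0.1 j : ℝ) ≤ ν j + Fintype.card I := by exact_mod_cast hub x0 hx0 j
    have a3 : (ν j : ℝ) ≤ x.1 j := by exact_mod_cast hνle x hx j
    have a4 : (ν j : ℝ) ≤ x0.1 j := by exact_mod_cast hνle x0 hx0 j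
    rw [abs_le]; constructor <;> linarith
  · left
    have := hub x0 hx0 i
    simp only [ν, if_neg hi, zero_add] at this
    simp only [pt]
    gcongr

theorem brouwer {I : Type*} [Fintype I] [Nonempty I] (f : (I → ℝ) → (I → ℝ))
    (hf : ∀ p ∈ stdSimplex ℝ I, f p ∈ stdSimplex ℝ I)
    (hfc : ContinuousOn f (stdSimplex ℝ I)) : ∃ p ∈ stdSimplex ℝ I, f p = p := by
  classical
  obtain ⟨i0⟩ : Nonempty I := inferInstance
  have hne : (stdSimplex ℝ I).Nonempty := ⟨_, single_mem_stdSimplex ℝ i0⟩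
  have hK : IsCompact (stdSimplex ℝ I) := isCompact_stdSimplex ℝ I
  have hfi : ∀ i, ContinuousOn (fun p => f p i) (stdSimplex ℝ I) := continuousOn_pi.1 hfc
  suffices h : ∃ p ∈ stdSimplex ℝ I, ∀ i, p i ≤ f p i by
    obtain ⟨p, hp, hle⟩ := h
    refine ⟨p, hp, ?_⟩
    have := (Finset.sum_eq_sum_iff_of_le (s := (Finset.univ : Finset I)) fun i _ => hle i).1
      (by rw [hp.2, (hf p hp).2])
    funext i
    exact (this i (Finset.mem_univ i)).symm
  rcases subsingleton_or_nontrivial I with hI | hI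
  · obtain ⟨p, hp⟩ := hne
    refine ⟨p, hp, fun i => ?_⟩
    have h1 := hp.2
    have h2 := (hf p hp).2
    rw [Fintype.sum_subsingleton _ i] at h1 h2
    rw [h1, h2]
  let φ : (I → ℝ) → ℝ := fun p => ∑ i, max (p i - f p i) 0
  have hφ : ContinuousOn φ (stdSimplex ℝ I) := by
    refine continuousOn_finsetSum _ fun i _ => ?_
    exact (((continuous_apply i).continuousOn).sub (hfi i)).sup continuousOn_const
  obtain ⟨p, hp, hmin⟩ := hK.exists_isMinOn hne hφ
  have hle : φ p ≤ 0 := by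
    have hcardpos : (0 : ℝ) < Fintype.card I := by exact_mod_cast Fintype.card_pos
    have huc := Metric.uniformContinuousOn_iff.1 (hK.uniformContinuousOn_of_continuous hfc)
    refine le_of_forall_pos_le_add fun ε hε => ?_
    set ε' := ε / (2 * Fintype.card I) with hε'
    have hε'p : 0 < ε' := by positivity
    obtain ⟨δ, hδ, hu⟩ := huc ε' hε'p
    obtain ⟨m, hm⟩ := exists_nat_gt ((Fintype.card I : ℝ) / min δ ε')
    have hmin' : 0 < min δ ε' := lt_min hδ hε'p
    have hm0 : (0 : ℝ) < m := lt_trans (by positivity) hm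
    have hmd : (Fintype.card I : ℝ) / m < min δ ε' := by
      rw [div_lt_iff₀ hmin'] at hm
      rw [div_lt_iff₀ hm0]; linarith
    obtain ⟨q, hq, h⟩ := brouwer_approx f hf m (by exact_mod_cast hm0)
    have hb : ∀ i, max (q i - f q i) 0 ≤ 2 * ε' := by
      intro i
      refine max_le ?_ (by positivity)
      rcases h i with h | ⟨s, hs, hqs, hsi⟩
      · have := (hf q hq).1 i
        have := min_le_right δ ε'
        linarith
      · have hd : dist q s < δ := by
          rw [dist_pi_lt_iff hδ]
          intro j
          rw [Real.dist_eq]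
          exact (hqs j).trans_lt (hmd.trans_le (min_le_left _ _))
        have h1 := hu q hq s hs hd
        have h2 := (dist_le_pi_dist (f q) (f s) i).trans_lt h1
        rw [Real.dist_eq, abs_lt] at h2
        have h3 := (abs_le.1 (hqs i)).2
        have := min_le_right δ ε'
        linarith [h2.1]
    calc φ p ≤ φ q := hmin hq
      _ ≤ ∑ i : I, 2 * ε' := Finset.sum_le_sum fun i _ => hb i
      _ = 0 + ε := by
        rw [Finset.sum_const, Finset.card_univ, nsmul_eq_mul, hε']
        field_simp
        ring
  refine ⟨p, hp, fun i => ?_⟩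
  have h1 := (Finset.single_le_sum (f := fun i => max (p i - f p i) 0)
    (fun _ _ => le_max_right _ _) (Finset.mem_univ i)).trans hle
  have := (le_max_left (p i - f p i) 0).trans h1
  linarith

end Ich

namespace Ich

theorem approx_fix {α V : Type*} [MetricSpace α] [CompactSpace α] [Nonempty α]
    [NormedAddCommGroup V] [NormedSpace ℝ V] (ι : α → V) (hι : Continuous ι)
    (hinj : Function.Injective ι) (hconv : Convex ℝ (range ι)) (F : α → Set α)
    (hne : ∀ x, (F x).Nonempty) (ε : ℝ) (hε : 0 < ε) :
    ∃ x, ι x ∈ convexHull ℝ (ι '' ⋃ u ∈ Metric.ball x ε, F u) := by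
  classical
  obtain ⟨t, -, htf, hcov⟩ := finite_cover_balls_of_compact (isCompact_univ (X := α)) hε
  haveI : Fintype t := htf.fintype
  have hcov' : ∀ x : α, ∃ j : t, dist x j < ε := by
    intro x
    have := hcov (mem_univ x)
    simp only [mem_iUnion, Metric.mem_ball] at this
    obtain ⟨j, hj, h⟩ := this
    exact ⟨⟨j, hj⟩, h⟩
  obtain ⟨a0⟩ : Nonempty α := inferInstance
  haveI : Nonempty t := ⟨(hcov' a0).choose⟩
  choose y hy using hne
  let w : t → α → ℝ := fun j x => max (ε - dist x j) 0
  have hw0 : ∀ j x, 0 ≤ w j x := fun j x => le_max_right _ _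
  let W : α → ℝ := fun x => ∑ j, w j x
  have hWpos : ∀ x, 0 < W x := by
    intro x
    obtain ⟨j, hj⟩ := hcov' x
    exact Finset.sum_pos' (fun j _ => hw0 j x) ⟨j, Finset.mem_univ _, lt_max_of_lt_left (by linarith)⟩
  have hwc : ∀ j, Continuous (w j) := fun j => by
    simp only [w]; fun_prop
  have hWc : Continuous W := continuous_finsetSum _ fun j _ => hwc j
  let φ : α → t → ℝ := fun x j => w j x / W x
  have hφc : Continuous φ := continuous_pi fun j => (hwc j).div hWc fun x => (hWpos x).ne'
  have hφs : ∀ x, φ x ∈ stdSimplex ℝ t := by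
    intro x
    refine ⟨fun j => div_nonneg (hw0 j x) (hWpos x).le, ?_⟩
    simp only [φ]
    rw [← Finset.sum_div]
    exact div_self (hWpos x).ne'
  have hs : ∀ p : t → ℝ, ∃ x : α, p ∈ stdSimplex ℝ t → ι x = ∑ j, p j • ι (y j) := by
    intro p
    by_cases hp : p ∈ stdSimplex ℝ t
    · have : ∑ j, p j • ι (y j) ∈ range ι :=
        hconv.sum_mem (fun j _ => hp.1 j) hp.2 fun j _ => mem_range_self _
      obtain ⟨x, hx⟩ := this
      exact ⟨x, fun _ => hx⟩
    · exact ⟨a0, fun h => absurd h hp⟩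
  choose s hs using hs
  have hsc : ContinuousOn s (stdSimplex ℝ t) := by
    rw [(hι.isClosedEmbedding hinj).isInducing.continuousOn_iff]
    have : ContinuousOn (fun p : t → ℝ => ∑ j, p j • ι (y j)) (stdSimplex ℝ t) := by fun_prop
    exact this.congr fun p hp => hs p hp
  obtain ⟨p, hp, hfix⟩ := brouwer (fun p => φ (s p)) (fun p _ => hφs _) (hφc.comp_continuousOn hsc)
  refine ⟨s p, ?_⟩
  rw [hs p hp, ← finsum_eq_sum_of_fintype]
  refine (convex_convexHull ℝ _).finsum_mem (fun j => hp.1 j)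
    (by rw [finsum_eq_sum_of_fintype]; exact hp.2) fun j hj => subset_convexHull ℝ _ ?_
  refine mem_image_of_mem _ (mem_iUnion₂.2 ⟨j, ?_, hy j⟩)
  rw [Metric.mem_ball, dist_comm]
  by_contra hcon
  push Not at hcon
  apply hj
  rw [← hfix]
  simp only [φ, w]
  rw [max_eq_right (by linarith), zero_div]

theorem kakutani {α V : Type*} [MetricSpace α] [CompactSpace α] [Nonempty α]
    [NormedAddCommGroup V] [NormedSpace ℝ V] (ι : α → V) (hι : Continuous ι)
    (hinj : Function.Injective ι) (hconv : Convex ℝ (range ι)) (F : α → Set α)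
    (hne : ∀ x, (F x).Nonempty) (hFc : ∀ x, Convex ℝ (ι '' F x))
    (hcl : IsClosed {p : α × α | p.2 ∈ F p.1}) : ∃ x, x ∈ F x := by
  have happ : ∀ k : ℕ, ∃ x, ι x ∈ convexHull ℝ (ι '' ⋃ u ∈ Metric.ball x (1 / ((k : ℝ) + 1)), F u) :=
    fun k => approx_fix ι hι hinj hconv F hne _ (by positivity)
  choose x hx using happ
  obtain ⟨a, -, ψ, hψ, hlim⟩ := (isCompact_univ (X := α)).tendsto_subseq (fun k => mem_univ (x k))
  refine ⟨a, ?_⟩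
  have hFa : IsClosed (F a) := hcl.preimage (by fun_prop : Continuous fun y : α => (a, y))
  have hImg : IsClosed (ι '' F a) := (hFa.isCompact.image hι).isClosed
  suffices h : ι a ∈ ι '' F a by
    obtain ⟨b, hb, hab⟩ := h
    exact hinj hab ▸ hb
  rw [← hImg.closure_eq, Metric.closure_eq_iInter_cthickening]
  refine mem_iInter₂.2 fun η hη => ?_
  let W : Set α := ι ⁻¹' (Metric.thickening η (ι '' F a))
  have hW : IsOpen W := Metric.isOpen_thickening.preimage hι
  have hFW : F a ⊆ W := fun z hz => Metric.self_subset_thickening hη _ (mem_image_of_mem _ hz)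
  have husc : ∀ᶠ u in nhds a, F u ⊆ W := by
    have h1 : IsClosed (Prod.fst '' ({p : α × α | p.2 ∈ F p.1} ∩ Prod.snd ⁻¹' Wᶜ)) :=
      isClosedMap_fst_of_compactSpace _ (hcl.inter (hW.isClosed_compl.preimage continuous_snd))
    have h2 : a ∉ Prod.fst '' ({p : α × α | p.2 ∈ F p.1} ∩ Prod.snd ⁻¹' Wᶜ) := by
      rintro ⟨⟨u, z⟩, ⟨hz, hzW⟩, rfl⟩
      exact hzW (hFW hz)
    filter_upwards [h1.isOpen_compl.mem_nhds h2] with u hu z hz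
    by_contra hzW
    exact hu ⟨(u, z), ⟨hz, hzW⟩, rfl⟩
  obtain ⟨δ, hδ, hball⟩ := Metric.eventually_nhds_iff.1 husc
  have hlim' : Filter.Tendsto (fun k => ι (x (ψ k))) Filter.atTop (nhds (ι a)) :=
    (hι.tendsto a).comp hlim
  refine Metric.isClosed_cthickening.mem_of_tendsto hlim' ?_
  have e1 : ∀ᶠ k in Filter.atTop, dist (x (ψ k)) a < δ / 2 :=
    Metric.tendsto_nhds.1 hlim _ (by positivity)
  have e2 : ∀ᶠ k in Filter.atTop, 1 / ((ψ k : ℝ) + 1) < δ / 2 :=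
    (tendsto_one_div_add_atTop_nhds_zero_nat.comp hψ.tendsto_atTop).eventually
      (gt_mem_nhds (by positivity))
  filter_upwards [e1, e2] with k h1 h2
  apply Metric.thickening_subset_cthickening
  refine convexHull_min ?_ ((hFc a).thickening η) (hx (ψ k))
  rintro _ ⟨z, hz, rfl⟩
  obtain ⟨u, hu, hzu⟩ := mem_iUnion₂.1 hz
  refine hball ?_ hzu
  calc dist u a ≤ dist u (x (ψ k)) + dist (x (ψ k)) a := dist_triangle _ _ _
    _ < δ := by rw [Metric.mem_ball] at hu; linarith

theorem closed_br {α β : Type*} [TopologicalSpace α] [TopologicalSpace β] [T2Space β]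
    [CompactSpace β] (F : α → Set β) (θ : α → β → ℝ)
    (husc : ∀ x, ∀ V : Set β, IsOpen V → F x ⊆ V → ∀ᶠ u in nhds x, F u ⊆ V)
    (hlsc : ∀ x, ∀ V : Set β, IsOpen V → (F x ∩ V).Nonempty → ∀ᶠ u in nhds x, (F u ∩ V).Nonempty)
    (hcl : ∀ x, IsClosed (F x))
    (hθ : ContinuousOn (fun p : α × β => θ p.1 p.2) {p : α × β | p.2 ∈ F p.1}) :
    IsClosed {p : α × β | p.2 ∈ F p.1 ∧ ∀ z ∈ F p.1, θ p.1 z ≤ θ p.1 p.2} := by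
  have hgr : IsClosed {p : α × β | p.2 ∈ F p.1} := by
    rw [← isOpen_compl_iff, isOpen_iff_mem_nhds]
    rintro ⟨x, y⟩ hxy
    obtain ⟨U, V, hU, hV, hyU, hFV, hd⟩ := SeparatedNhds.of_isCompact_isCompact
      (isCompact_singleton (x := y)) (hcl x).isCompact (by
        rw [Set.disjoint_singleton_left]; exact hxy)
    rw [nhds_prod_eq]
    filter_upwards [(husc x V hV hFV).prod_mk (hU.mem_nhds (hyU rfl))] with p hp hpF
    exact Set.disjoint_left.1 hd hp.2 (hp.1 hpF)
  rw [isClosed_iff_frequently]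
  rintro ⟨x, y⟩ hfr
  have hy : y ∈ F x := (isClosed_iff_frequently.1 hgr) (x, y) (hfr.mono fun p hp => hp.1)
  refine ⟨hy, fun z hz => ?_⟩
  by_contra hlt
  push Not at hlt
  obtain ⟨c, hc1, hc2⟩ := exists_between hlt
  have h1 := (hθ (x, z) hz).eventually (lt_mem_nhds hc2)
  have h2 := (hθ (x, y) hy).eventually (gt_mem_nhds hc1)
  rw [eventually_nhdsWithin_iff] at h1 h2
  rw [nhds_prod_eq] at h1
  obtain ⟨pa, ha, pb, hb, hab⟩ := Filter.eventually_prod_iff.1 h1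
  obtain ⟨W, hWsub, hWo, hzW⟩ := mem_nhds_iff.1 hb
  have h3 := (hlsc x W hWo ⟨z, hz, hzW⟩).and ha
  have h4 : ∀ᶠ p : α × β in nhds (x, y), (F p.1 ∩ W).Nonempty ∧ pa p.1 :=
    (continuous_fst.tendsto (x, y)).eventually h3
  obtain ⟨⟨u, v⟩, ⟨hv, hmax⟩, ⟨⟨z', hz', hzW'⟩, hpa⟩, hlt'⟩ := (hfr.and_eventually (h4.and h2)).exists
  have h5 := hab hpa (hWsub hzW') hz'
  have h6 := hlt' hv
  have h7 := hmax z' hz'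
  simp only at h5 h6 h7
  linarith

end Ich

/-- Ichiishi's Nash equilibrium existence theorem.  Each decision space is a
nonempty compact convex subset `K i` of a Euclidean space `ℝ^{n i}`; the
constraint maps are strict, upper and lower semicontinuous and closed-valued;
each payoff function is continuous on the graph of the constraint map; and
each payoff is quasi-concave in the player's own variable on the (convex)
value `X i x`.  Then the economy has a Nash equilibrium. -/
theorem ichiishi_exists_nashEquilibrium
    {N : ℕ} (hN : 1 ≤ N) (n : Fin N → ℕ)
    (K : ∀ i, Set (EuclideanSpace ℝ (Fin (n i))))
    (hKne : ∀ i, (K i).Nonempty)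
    (hKcv : ∀ i, Convex ℝ (K i))
    (hKcp : ∀ i, IsCompact (K i))
    (X : ∀ i, (∀ j, ↥(K j)) → Set ↥(K i))
    (θ : ∀ i, (∀ j, ↥(K j)) → ↥(K i) → ℝ)
    (hstrict : ∀ (i : Fin N) (x : ∀ j, ↥(K j)), (X i x).Nonempty)
    (hfix : ∃ x : ∀ j, ↥(K j), ∀ i, x i ∈ X i x)
    (husc : ∀ i, SVUpperSemicontinuous (X i))
    (hlsc : ∀ i, SVLowerSemicontinuous (X i))
    (hclosed : ∀ (i : Fin N) (x : ∀ j, ↥(K j)), IsClosed (X i x))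
    (hθ : ∀ i, ContinuousOn (fun p : (∀ j, ↥(K j)) × ↥(K i) => θ i p.1 p.2)
      {p : (∀ j, ↥(K j)) × ↥(K i) | p.2 ∈ X i p.1})
    (hXconv : ∀ (i : Fin N) (x : ∀ j, ↥(K j)),
      Convex ℝ (Subtype.val '' X i x))
    (hquasi : ∀ (i : Fin N) (x : ∀ j, ↥(K j)),
      ∀ y ∈ X i x, ∀ z ∈ X i x, ∀ t ∈ Icc (0 : ℝ) 1, ∀ w ∈ X i x,
        (w : EuclideanSpace ℝ (Fin (n i)))
            = t • (y : EuclideanSpace ℝ (Fin (n i)))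
              + (1 - t) • (z : EuclideanSpace ℝ (Fin (n i))) →
        min (θ i x y) (θ i x z) ≤ θ i x w) :
    ∃ x : ∀ j, ↥(K j), IsNashEquilibrium X θ x := by
  classical
  haveI : ∀ j, CompactSpace ↥(K j) := fun j => isCompact_iff_compactSpace.1 (hKcp j)
  haveI : ∀ j, Nonempty ↥(K j) := fun j => (hKne j).to_subtype
  let ι : (∀ j, ↥(K j)) → (∀ j, EuclideanSpace ℝ (Fin (n j))) := fun x j => (x j : _)
  let F : (∀ j, ↥(K j)) → Set (∀ j, ↥(K j)) := fun x =>
    {y | ∀ i, y i ∈ X i x ∧ ∀ z ∈ X i x, θ i x z ≤ θ i x (y i)}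
  obtain ⟨x, hx⟩ := Ich.kakutani ι (by fun_prop)
    (fun x y h => funext fun j => Subtype.ext (congrFun h j))
    (by
      rintro _ ⟨x, rfl⟩ _ ⟨y, rfl⟩ a b ha hb hab
      exact ⟨fun j => ⟨_, hKcv j (x j).2 (y j).2 ha hb hab⟩, rfl⟩)
    F
    (by
      intro x
      have : ∀ i, ∃ y ∈ X i x, ∀ z ∈ X i x, θ i x z ≤ θ i x y := by
        intro i
        have hc : ContinuousOn (θ i x) (X i x) :=
          (hθ i).comp (f := fun y : ↥(K i) => (x, y)) (by fun_prop) (fun y hy => hy)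
        obtain ⟨y, hy, hmax⟩ := (hclosed i x).isCompact.exists_isMaxOn (hstrict i x) hc
        exact ⟨y, hy, fun z hz => hmax hz⟩
      choose y hy using this
      exact ⟨y, hy⟩)
    (by
      rintro x _ ⟨y, hy, rfl⟩ _ ⟨y', hy', rfl⟩ a b ha hb hab
      have : ∀ i, ∃ w ∈ X i x, (w : EuclideanSpace ℝ (Fin (n i))) =
          a • (y i : EuclideanSpace ℝ (Fin (n i))) + b • (y' i : EuclideanSpace ℝ (Fin (n i))) := by
        intro i
        obtain ⟨w, hw, he⟩ := hXconv i x (mem_image_of_mem _ (hy i).1)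
          (mem_image_of_mem _ (hy' i).1) ha hb hab
        exact ⟨w, hw, he⟩
      choose w hw he using this
      refine ⟨w, fun i => ⟨hw i, fun z hz => ?_⟩, funext fun i => he i⟩
      have hb' : b = 1 - a := by linarith
      refine le_trans (le_min ((hy i).2 z hz) ((hy' i).2 z hz))
        (hquasi i x (y i) (hy i).1 (y' i) (hy' i).1 a ⟨ha, by linarith⟩ (w i) (hw i) ?_)
      rw [he i, hb'])
    (by
      have : {p : (∀ j, ↥(K j)) × (∀ j, ↥(K j)) | p.2 ∈ F p.1} =
          ⋂ i, (fun p : (∀ j, ↥(K j)) × (∀ j, ↥(K j)) => (p.1, p.2 i)) ⁻¹'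
            {p : (∀ j, ↥(K j)) × ↥(K i) | p.2 ∈ X i p.1 ∧ ∀ z ∈ X i p.1, θ i p.1 z ≤ θ i p.1 p.2} := by
        ext p
        simp only [F, mem_iInter]
        rfl
      rw [this]
      exact isClosed_iInter fun i => (Ich.closed_br (X i) (θ i) (husc i) (hlsc i) (hclosed i)
        (hθ i)).preimage (by fun_prop))
  exact ⟨x, hx⟩
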